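/- There is a universal constant c > 0 such that for all sufficiently large n there exists a convex body K ⊂ ℝⁿ in John's position with the following property: every polytope P of the form P = {x ∈ ℝⁿ : ⟨x, w_l⟩ ≤ 1 for l = 1, …, m} satisfying K ⊆ P ⊆ √n·K must have m ≥ exp(c·n). -/

import Mathlib

open MeasureTheory RealInnerProductSpace Pointwise

/-- A convex body: compact, convex, with nonempty interior. -/
def IsConvexBody {n : ℕ} (K : Set (EuclideanSpace ℝ (Fin n))) : Prop :=
  IsCompact K ∧ Convex ℝ K ∧ (interior K).Nonempty

/-- An ellipsoid: the image of the unit Euclidean ball under an invertible affine map. -/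
def IsEllipsoid {n : ℕ} (E : Set (EuclideanSpace ℝ (Fin n))) : Prop :=
  ∃ T : EuclideanSpace ℝ (Fin n) ≃ᵃ[ℝ] EuclideanSpace ℝ (Fin n),
    E = T '' (Metric.closedBall 0 1)

/-- A convex body is in John's position if it contains the unit ball and every ellipsoid
contained in it has volume at most that of the unit ball. -/
def InJohnPosition {n : ℕ} (K : Set (EuclideanSpace ℝ (Fin n))) : Prop :=
  Metric.closedBall 0 1 ⊆ K ∧
    ∀ E : Set (EuclideanSpace ℝ (Fin n)), IsEllipsoid E → E ⊆ K →
      volume E ≤ volume (Metric.closedBall (0 : EuclideanSpace ℝ (Fin n)) 1)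

/-- The determinant of the adjoint of a real endomorphism equals the determinant. -/
theorem LinearMap.det_adjoint_real {E : Type*} [NormedAddCommGroup E] [InnerProductSpace ℝ E]
    [FiniteDimensional ℝ E] (A : E →ₗ[ℝ] E) : LinearMap.det (LinearMap.adjoint A) = LinearMap.det A := by
  have b := stdOrthonormalBasis ℝ E
  rw [← LinearMap.det_toMatrix b.toBasis, ← LinearMap.det_toMatrix b.toBasis A,
    LinearMap.toMatrix_adjoint, Matrix.det_conjTranspose, star_trivial]

/-- If the vectors `u i` with weights `c i` form a decomposition of the identity by unit vectors,
then `∑ c i * ‖A (u i)‖ ≤ n` forces `|det A| ≤ 1`. -/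
theorem abs_det_le_one_of_sum_norm_le {n : ℕ} {ι : Type*} [Fintype ι]
    (u : ι → EuclideanSpace ℝ (Fin n)) (c : ι → ℝ) (hc : ∀ i, 0 ≤ c i) (hu : ∀ i, ‖u i‖ = 1)
    (hid : ∀ x : EuclideanSpace ℝ (Fin n), ∑ i, c i * ⟪x, u i⟫ ^ 2 = ‖x‖ ^ 2)
    (A : EuclideanSpace ℝ (Fin n) →ₗ[ℝ] EuclideanSpace ℝ (Fin n))
    (hA : ∑ i, c i * ‖A (u i)‖ ≤ n) : |LinearMap.det A| ≤ 1 := by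
  have hn : Module.finrank ℝ (EuclideanSpace ℝ (Fin n)) = n := by simp
  have hS := A.isSymmetric_adjoint_comp_self
  set f := hS.eigenvectorBasis hn with hf
  set lam := hS.eigenvalues hn with hlam
  have happ : ∀ x y, ⟪(LinearMap.adjoint A ∘ₗ A) x, y⟫ = ⟪A x, A y⟫ := fun x y => by
    simp [LinearMap.adjoint_inner_left]
  have hlam0 : ∀ k, 0 ≤ lam k := fun k => by
    have h1 := happ (f k) (f k)
    rw [hf, hS.apply_eigenvectorBasis hn k, inner_smul_left, real_inner_self_eq_norm_sq,
      real_inner_self_eq_norm_sq] at h1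
    simp only [OrthonormalBasis.norm_eq_one] at h1
    have : lam k = ‖A (hS.eigenvectorBasis hn k)‖ ^ 2 := by simpa using h1
    rw [this]; positivity
  have hnorm : ∀ x, ‖A x‖ ^ 2 = ∑ k, lam k * ⟪f k, x⟫ ^ 2 := fun x => by
    rw [← real_inner_self_eq_norm_sq, ← happ, ← f.sum_inner_mul_inner]
    refine Finset.sum_congr rfl fun k _ => ?_
    rw [hS x (f k), hf, hS.apply_eigenvectorBasis hn k, inner_smul_right, real_inner_comm x]
    simp only [hlam, RCLike.ofReal_real_eq_id, id]
    ring
  have hjensen : ∀ i, ∑ k, √(lam k) * ⟪f k, u i⟫ ^ 2 ≤ ‖A (u i)‖ := fun i => by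
    have hp : ∑ k, ⟪f k, u i⟫ ^ 2 = 1 := by
      rw [f.sum_sq_inner_right, hu, one_pow]
    set t := ∑ k, √(lam k) * ⟪f k, u i⟫ ^ 2 with ht
    have h0 : 0 ≤ ∑ k, (√(lam k) - t) ^ 2 * ⟪f k, u i⟫ ^ 2 :=
      Finset.sum_nonneg fun k _ => by positivity
    have h1 : ∑ k, (√(lam k) - t) ^ 2 * ⟪f k, u i⟫ ^ 2 = ‖A (u i)‖ ^ 2 - t ^ 2 := by
      have : ∀ k, (√(lam k) - t) ^ 2 * ⟪f k, u i⟫ ^ 2 = lam k * ⟪f k, u i⟫ ^ 2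
          - 2 * t * (√(lam k) * ⟪f k, u i⟫ ^ 2) + t ^ 2 * ⟪f k, u i⟫ ^ 2 := fun k => by
        linear_combination ⟪f k, u i⟫ ^ 2 * Real.sq_sqrt (hlam0 k)
      simp only [this, Finset.sum_add_distrib, Finset.sum_sub_distrib, ← Finset.mul_sum, hp,
        ← ht, ← hnorm]
      ring
    exact le_of_sq_le_sq (by linarith) (norm_nonneg _)
  have htrace : ∑ k, √(lam k) ≤ n := by
    refine le_trans (le_of_eq ?_) ((Finset.sum_le_sum fun i _ =>
      mul_le_mul_of_nonneg_left (hjensen i) (hc i)).trans hA)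
    simp only [Finset.mul_sum]
    rw [Finset.sum_comm]
    refine Finset.sum_congr rfl fun k _ => ?_
    have := hid (f k)
    rw [f.norm_eq_one, one_pow] at this
    calc √(lam k) = √(lam k) * ∑ i, c i * ⟪f k, u i⟫ ^ 2 := by rw [this, mul_one]
      _ = _ := by rw [Finset.mul_sum]; exact Finset.sum_congr rfl fun i _ => by ring
  have hprod : ∏ k, √(lam k) ≤ 1 := by
    calc ∏ k, √(lam k) ≤ ∏ k, Real.exp (√(lam k) - 1) :=
          Finset.prod_le_prod (fun k _ => Real.sqrt_nonneg _) fun k _ => by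
            linarith [Real.add_one_le_exp (√(lam k) - 1)]
      _ = Real.exp (∑ k, √(lam k) - n) := by
          rw [← Real.exp_sum, Finset.sum_sub_distrib]; simp
      _ ≤ 1 := Real.exp_le_one_iff.2 (by linarith)
  have hdet : LinearMap.det A ^ 2 = (∏ k, √(lam k)) ^ 2 := by
    rw [← Finset.prod_pow]
    simp only [Real.sq_sqrt (hlam0 _)]
    have := hS.det_eq_prod_eigenvalues hn
    rw [LinearMap.det_comp, LinearMap.det_adjoint_real] at this
    rw [sq, this]; rfl
  rw [← sq_le_one_iff_abs_le_one, hdet]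
  exact pow_le_one₀ (Finset.prod_nonneg fun k _ => Real.sqrt_nonneg _) hprod

/-- The sufficiency part of John's theorem. -/
theorem inJohnPosition_of_decomposition {n : ℕ} {ι : Type*} [Fintype ι]
    (u : ι → EuclideanSpace ℝ (Fin n)) (c : ι → ℝ) (hc : ∀ i, 0 ≤ c i) (hu : ∀ i, ‖u i‖ = 1)
    (hid : ∀ x : EuclideanSpace ℝ (Fin n), ∑ i, c i * ⟪x, u i⟫ ^ 2 = ‖x‖ ^ 2)
    (hsum : ∑ i, c i • u i = 0) (hcn : ∑ i, c i ≤ n) {K : Set (EuclideanSpace ℝ (Fin n))}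
    (hK : Metric.closedBall 0 1 ⊆ K) (hKu : ∀ x ∈ K, ∀ i, ⟪x, u i⟫ ≤ 1) : InJohnPosition K := by
  refine ⟨hK, ?_⟩
  rintro _ ⟨T, rfl⟩ hE
  set L : EuclideanSpace ℝ (Fin n) →ₗ[ℝ] EuclideanSpace ℝ (Fin n) :=
    (T.linear : EuclideanSpace ℝ (Fin n) →ₗ[ℝ] EuclideanSpace ℝ (Fin n)) with hL
  have hT : ∀ x, T x = T 0 + L x := fun x => by
    have := T.map_vadd 0 x
    simpa [add_comm, hL] using this
  have hsupp : ∀ i, ‖LinearMap.adjoint L (u i)‖ ≤ 1 - ⟪T 0, u i⟫ := fun i => by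
    set a := LinearMap.adjoint L (u i) with ha
    have hmem : (‖a‖⁻¹ • a) ∈ Metric.closedBall (0 : EuclideanSpace ℝ (Fin n)) 1 := by
      rw [mem_closedBall_zero_iff, norm_smul, norm_inv, norm_norm]
      exact inv_mul_le_one
    have h1 := hKu _ (hE ⟨_, hmem, rfl⟩) i
    rw [hT, inner_add_left, map_smul, inner_smul_left, ← LinearMap.adjoint_inner_right, ← ha,
      real_inner_self_eq_norm_sq] at h1
    have h2 : ‖a‖⁻¹ * ‖a‖ ^ 2 = ‖a‖ := by
      rcases eq_or_ne ‖a‖ 0 with h | h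
      · simp [h]
      · field_simp
    simp only [conj_trivial] at h1
    linarith
  have hdet : |LinearMap.det L| ≤ 1 := by
    rw [← LinearMap.det_adjoint_real]
    refine abs_det_le_one_of_sum_norm_le u c hc hu hid _ ?_
    have h0 : ∑ i, c i * ⟪T 0, u i⟫ = 0 := by
      simpa [inner_sum, inner_smul_right] using congrArg (fun y => ⟪T 0, y⟫) hsum
    calc ∑ i, c i * ‖LinearMap.adjoint L (u i)‖ ≤ ∑ i, c i * (1 - ⟪T 0, u i⟫) :=
          Finset.sum_le_sum fun i _ => mul_le_mul_of_nonneg_left (hsupp i) (hc i)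
      _ ≤ n := by
          simp only [mul_sub, mul_one, Finset.sum_sub_distrib, h0]; linarith
  have himg : T '' Metric.closedBall 0 1 = T 0 +ᵥ (L '' Metric.closedBall 0 1) := by
    ext y
    simp only [Set.mem_vadd_set, Set.mem_image, exists_exists_and_eq_and, vadd_eq_add, ← hT]
  rw [himg, measure_vadd, Measure.addHaar_image_linearMap]
  calc _ ≤ ENNReal.ofReal 1 * volume (Metric.closedBall (0 : EuclideanSpace ℝ (Fin n)) 1) := by
        gcongr
    _ = _ := by simp

/-- A Gilbert–Varshamov bound: an exponentially large code over an alphabet of `64` letters in which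
distinct words agree in at most a third of the positions. -/
theorem exists_code_few_agreements (k : ℕ) :
    ∃ C : Finset (Fin k → Fin 64),
      (∀ f ∈ C, ∀ g ∈ C, f ≠ g → 3 * (Finset.univ.filter fun i => f i = g i).card ≤ k) ∧
      (128 / 71 : ℝ) ^ k ≤ C.card := by
  classical
  set agree : (Fin k → Fin 64) → (Fin k → Fin 64) → ℕ :=
    fun f g => (Finset.univ.filter fun i => f i = g i).card with hagree
  have hcount : ∀ f, (Finset.univ.filter fun g => k ≤ 3 * agree f g).card * 2 ^ k ≤ 71 ^ k := by
    intro f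
    have hgen : ∑ g, 8 ^ agree f g = 71 ^ k := by
      have h1 : ∀ g, 8 ^ agree f g = ∏ i, if f i = g i then 8 else 1 := fun g => by
        rw [Finset.prod_ite]; simp [hagree]
      have h2 := Finset.prod_univ_sum (fun _ : Fin k => (Finset.univ : Finset (Fin 64)))
        (fun i a => if f i = a then 8 else 1)
      rw [Fintype.piFinset_univ] at h2
      rw [Finset.sum_congr rfl fun g _ => h1 g, ← h2]
      have h3 : ∀ a : Fin 64, ∑ b : Fin 64, (if a = b then 8 else 1) = 71 := fun a => by
        have h4 : ∀ b : Fin 64, (if a = b then 8 else 1) = 1 + if a = b then 7 else 0 :=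
          fun b => by split_ifs <;> rfl
        simp [h4, Finset.sum_add_distrib]
      simp [h3]
    rw [← hgen, ← smul_eq_mul, ← Finset.sum_const]
    refine le_trans (Finset.sum_le_sum fun g hg => ?_)
      (Finset.sum_le_sum_of_subset (Finset.filter_subset _ _))
    rw [show 8 = 2 ^ 3 from rfl, ← pow_mul]
    exact Nat.pow_le_pow_right two_pos (Finset.mem_filter.1 hg).2
  obtain ⟨C, hC⟩ := (Finset.univ.filter fun C : Finset (Fin k → Fin 64) =>
    ∀ f ∈ C, ∀ g ∈ C, f ≠ g → 3 * agree f g ≤ k).exists_maximal ⟨∅, by simp⟩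
  have hCcode := (Finset.mem_filter.1 hC.prop).2
  refine ⟨C, hCcode, ?_⟩
  have hcomm : ∀ f g, agree f g = agree g f := fun f g => by simp only [hagree, eq_comm]
  have hcover : (Finset.univ : Finset (Fin k → Fin 64)) ⊆
      C.biUnion fun f => Finset.univ.filter fun g => k ≤ 3 * agree f g := by
    intro g _
    by_contra hg
    simp only [Finset.mem_biUnion, Finset.mem_filter, Finset.mem_univ, true_and, not_exists,
      not_and, not_le] at hg
    have hgC : g ∉ C := fun h => by
      have := hg g h
      simp [hagree] at this
      omega
    refine hgC (hC.le_of_ge (y := insert g C) ?_ (Finset.subset_insert _ _)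
      (Finset.mem_insert_self _ _))
    simp only [Finset.mem_filter, Finset.mem_univ, true_and, Finset.mem_insert]
    rintro a (rfl | ha) b (rfl | hb) hab
    · exact absurd rfl hab
    · rw [hcomm]; exact (hg b hb).le
    · exact (hg a ha).le
    · exact hCcode a ha b hb hab
  have hle : 64 ^ k * 2 ^ k ≤ C.card * 71 ^ k := by
    calc 64 ^ k * 2 ^ k = (Finset.univ : Finset (Fin k → Fin 64)).card * 2 ^ k := by simp
      _ ≤ (∑ f ∈ C, (Finset.univ.filter fun g => k ≤ 3 * agree f g).card) * 2 ^ k :=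
          Nat.mul_le_mul_right _ ((Finset.card_le_card hcover).trans Finset.card_biUnion_le)
      _ ≤ ∑ f ∈ C, 71 ^ k := by
          rw [Finset.sum_mul]; exact Finset.sum_le_sum fun f _ => hcount f
      _ = C.card * 71 ^ k := by simp
  rw [div_pow, div_le_iff₀ (by positivity), show (128 : ℝ) = 64 * 2 by norm_num, mul_pow]
  exact_mod_cast hle

/-- An exponentially large family of sets of density about `1 / 64` with small intersections. -/
theorem exists_finset_family_small_inter {n k : ℕ} (h : k * 64 ≤ n) :
    ∃ C : Finset (Finset (Fin n)), (∀ A ∈ C, A.card = k) ∧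
      (∀ A ∈ C, ∀ B ∈ C, A ≠ B → 3 * (A ∩ B).card ≤ k) ∧ (128 / 71 : ℝ) ^ k ≤ C.card := by
  classical
  obtain ⟨C, hC, hcard⟩ := exists_code_few_agreements k
  set e : Fin k × Fin 64 → Fin n := fun p => Fin.castLE h (finProdFinEquiv p) with he
  have hinj : Function.Injective e := (Fin.castLE_injective h).comp finProdFinEquiv.injective
  set S : (Fin k → Fin 64) → Finset (Fin n) :=
    fun f => Finset.univ.image (fun i => e (i, f i)) with hS
  have hSinj : ∀ f : Fin k → Fin 64, Function.Injective (fun i => e (i, f i)) := fun f i j hij =>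
    congrArg Prod.fst (hinj hij)
  have hScard : ∀ f, (S f).card = k := fun f => by
    rw [hS, Finset.card_image_of_injective _ (hSinj f)]; simp
  have hinter : ∀ f g, S f ∩ S g =
      (Finset.univ.filter fun i => f i = g i).image fun i => e (i, f i) := fun f g => by
    ext j
    simp only [hS, Finset.mem_inter, Finset.mem_image, Finset.mem_univ, true_and,
      Finset.mem_filter]
    constructor
    · rintro ⟨⟨i, rfl⟩, i', hi'⟩
      have := hinj hi'
      simp only [Prod.mk.injEq] at this
      obtain ⟨rfl, h2⟩ := this
      exact ⟨i', h2.symm, rfl⟩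
    · rintro ⟨i, hi, rfl⟩
      exact ⟨⟨i, rfl⟩, i, by rw [hi]⟩
  have hSS : Function.Injective S := fun f g hfg => by
    have h1 := hinter f g
    rw [← hfg, Finset.inter_self] at h1
    have h2 := congrArg Finset.card h1
    rw [hScard, Finset.card_image_of_injective _ (hSinj f)] at h2
    have h3 := (Finset.card_eq_iff_eq_univ (Finset.univ.filter fun i => f i = g i)).1
      (by rw [← h2]; simp)
    funext i
    have h4 := Finset.mem_univ i
    rw [← h3] at h4
    exact (Finset.mem_filter.1 h4).2
  refine ⟨C.image S, ?_, ?_, ?_⟩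
  · simp [hScard]
  · simp only [Finset.mem_image]
    rintro _ ⟨f, hf, rfl⟩ _ ⟨g, hg, rfl⟩ hfg
    rw [hinter, Finset.card_image_of_injective _ (hSinj f)]
    exact hC f hf g hg fun h => hfg (h ▸ rfl)
  · rwa [Finset.card_image_of_injective _ hSS]

theorem EuclideanSpace.real_inner_eq_sum {ι : Type*} [Fintype ι] (x y : EuclideanSpace ℝ ι) :
    ⟪x, y⟫ = ∑ j, x j * y j := by
  simp [PiLp.inner_apply, mul_comm]

/-- Points `x A` lying outside `√n • K` such that averages of many of them lie in `K` force any
polytope between `K` and `√n • K` to have many facets. -/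
theorem exists_inJohnPosition_many_facets {n : ℕ} {ι κ : Type*} [Fintype ι]
    (u : ι → EuclideanSpace ℝ (Fin n)) (c : ι → ℝ) (hc : ∀ i, 0 ≤ c i) (hu : ∀ i, ‖u i‖ = 1)
    (hid : ∀ x : EuclideanSpace ℝ (Fin n), ∑ i, c i * ⟪x, u i⟫ ^ 2 = ‖x‖ ^ 2)
    (hsum : ∑ i, c i • u i = 0) (hcn : ∑ i, c i ≤ n)
    (C : Finset κ) (v x : κ → EuclideanSpace ℝ (Fin n)) (D : ℝ) (hD : 0 < D)
    (hv : ∀ A, ‖v A‖ ≤ 1) (hxu : ∀ A ∈ C, ∀ i, ⟪x A, u i⟫ ≤ 1)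
    (hxv : ∀ A ∈ C, ∀ B ∈ C, A ≠ B → ⟪x A, v B⟫ ≤ 0)
    (hlow : ∀ A ∈ C, √n < ⟪x A, v A⟫) (hup : ∀ A ∈ C, ⟪x A, v A⟫ ≤ D) :
    ∃ K : Set (EuclideanSpace ℝ (Fin n)), IsConvexBody K ∧ InJohnPosition K ∧
      ∀ (m : ℕ) (w : Fin m → EuclideanSpace ℝ (Fin n)),
        K ⊆ {x | ∀ l, ⟪x, w l⟫ ≤ 1} →
        {x : EuclideanSpace ℝ (Fin n) | ∀ l, ⟪x, w l⟫ ≤ 1} ⊆ √n • K → (C.card : ℝ) ≤ m * D := by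
  classical
  set R : ℝ := 1 + ∑ A ∈ C, ‖x A‖ with hR
  have hR1 : 1 ≤ R := le_add_of_nonneg_right (Finset.sum_nonneg fun _ _ => norm_nonneg _)
  have hxR : ∀ A ∈ C, x A ∈ Metric.closedBall 0 R := fun A hA => by
    rw [mem_closedBall_zero_iff]
    have := Finset.single_le_sum (f := fun A => ‖x A‖) (fun _ _ => norm_nonneg _) hA
    linarith
  set K : Set (EuclideanSpace ℝ (Fin n)) :=
    (⋂ i, {y | ⟪y, u i⟫ ≤ 1}) ∩ (⋂ A ∈ C, {y | ⟪y, v A⟫ ≤ 1}) ∩ Metric.closedBall 0 R with hK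
  have hhalf : ∀ z : EuclideanSpace ℝ (Fin n), Convex ℝ {y | ⟪y, z⟫ ≤ 1} := fun z => by
    simp only [real_inner_comm]
    exact convex_halfSpace_le (innerSL ℝ z).toLinearMap.isLinear 1
  have hclosed : ∀ z : EuclideanSpace ℝ (Fin n), IsClosed {y | ⟪y, z⟫ ≤ 1} := fun z =>
    isClosed_le (by fun_prop) continuous_const
  have hball : ∀ z : EuclideanSpace ℝ (Fin n), ‖z‖ ≤ 1 →
      Metric.closedBall 0 1 ⊆ {y : EuclideanSpace ℝ (Fin n) | ⟪y, z⟫ ≤ 1} := fun z hz y hy => by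
    rw [mem_closedBall_zero_iff] at hy
    exact (real_inner_le_norm y z).trans (mul_le_one₀ hy (norm_nonneg _) hz)
  have hBK : Metric.closedBall 0 1 ⊆ K := Set.subset_inter (Set.subset_inter
    (Set.subset_iInter fun i => hball _ (hu i).le)
    (Set.subset_iInter₂ fun A _ => hball _ (hv A))) (Metric.closedBall_subset_closedBall hR1)
  have hKconv : Convex ℝ K := ((convex_iInter fun i => hhalf _).inter
    (convex_iInter₂ fun A _ => hhalf _)).inter (convex_closedBall _ _)
  have hKu : ∀ y ∈ K, ∀ i, ⟪y, u i⟫ ≤ 1 := fun y hy i => Set.mem_iInter.1 hy.1.1 i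
  refine ⟨K, ⟨?_, hKconv, ?_⟩, inJohnPosition_of_decomposition u c hc hu hid hsum hcn hBK hKu, ?_⟩
  · exact (isCompact_closedBall _ _).inter_left ((isClosed_iInter fun i => hclosed _).inter
      (isClosed_biInter fun A _ => hclosed _))
  · exact ⟨0, interior_mono (Metric.ball_subset_closedBall.trans hBK)
      (by rw [Metric.isOpen_ball.interior_eq]; simp)⟩
  intro m w hKP hPK
  have hviol : ∀ A ∈ C, ∃ l, 1 < ⟪x A, w l⟫ := by
    intro A hA
    by_contra! hcon
    obtain ⟨y, hy, hyx⟩ := hPK hcon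
    have h1 : ⟪y, v A⟫ ≤ 1 := Set.mem_iInter₂.1 hy.1.2 A hA
    have h2 := hlow A hA
    simp only at hyx
    rw [← hyx, inner_smul_left, conj_trivial] at h2
    nlinarith [Real.sqrt_nonneg n]
  have hfew : ∀ l, ((C.filter fun A => 1 < ⟪x A, w l⟫).card : ℝ) ≤ D := by
    intro l
    set S := C.filter fun A => 1 < ⟪x A, w l⟫ with hS
    have hSC : S ⊆ C := Finset.filter_subset _ _
    by_contra! hcard
    have hpos : (0 : ℝ) < S.card := hD.trans hcard
    have hne : S.Nonempty := Finset.card_pos.1 (by exact_mod_cast hpos)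
    set y := (S.card : ℝ)⁻¹ • ∑ A ∈ S, x A with hy
    have hinner : ∀ z, ⟪y, z⟫ = (S.card : ℝ)⁻¹ * ∑ A ∈ S, ⟪x A, z⟫ := fun z => by
      rw [hy, inner_smul_left, conj_trivial, sum_inner]
    have hle : ∀ z, ∑ A ∈ S, ⟪x A, z⟫ ≤ S.card → ⟪y, z⟫ ≤ 1 := fun z hz => by
      rw [hinner]
      exact (inv_mul_le_one₀ hpos).2 hz
    have hyK : y ∈ K := by
      refine ⟨⟨Set.mem_iInter.2 fun i => hle _ ?_, Set.mem_iInter₂.2 fun B hB => hle _ ?_⟩, ?_⟩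
      · simpa using Finset.sum_le_card_nsmul S _ 1 fun A hA => hxu A (hSC hA) i
      · have h1 : ∀ A ∈ S, ⟪x A, v B⟫ ≤ if A = B then D else 0 := fun A hA => by
          split_ifs with h
          · exact h ▸ hup A (hSC hA)
          · exact hxv A (hSC hA) B hB h
        refine (Finset.sum_le_sum h1).trans ?_
        rw [Finset.sum_ite_eq' S B]
        split_ifs <;> linarith
      · rw [hy, Finset.smul_sum]
        refine (convex_closedBall _ _).sum_mem (fun _ _ => by positivity) ?_
          fun A hA => hxR A (hSC hA)
        simp [hpos.ne']
    have h1 := hKP hyK l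
    have h2 : (S.card : ℝ) < ∑ A ∈ S, ⟪x A, w l⟫ := by
      have := Finset.sum_lt_sum_of_nonempty hne (f := fun _ => (1 : ℝ))
        fun A hA => (Finset.mem_filter.1 hA).2
      simpa using this
    rw [hinner, inv_mul_le_one₀ hpos] at h1
    linarith
  have hcover : C ⊆ Finset.univ.biUnion fun l => C.filter fun A => 1 < ⟪x A, w l⟫ := fun A hA => by
    obtain ⟨l, hl⟩ := hviol A hA
    simp only [Finset.mem_biUnion, Finset.mem_filter, Finset.mem_univ, true_and]
    exact ⟨l, hA, hl⟩
  calc (C.card : ℝ) ≤ ∑ l, ((C.filter fun A => 1 < ⟪x A, w l⟫).card : ℝ) := by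
        exact_mod_cast (Finset.card_le_card hcover).trans Finset.card_biUnion_le
    _ ≤ ∑ _l : Fin m, D := Finset.sum_le_sum fun l _ => hfew l
    _ = m * D := by simp

/-- The vertices of a regular simplex inscribed in the unit sphere of `ℝⁿ`. -/
noncomputable def simplexVertex (n : ℕ) : Option (Fin n) → EuclideanSpace ℝ (Fin n)
  | none => WithLp.toLp 2 fun _ => (√n)⁻¹
  | some i => WithLp.toLp 2 fun j =>
      (if j = i then √(1 + (n : ℝ)⁻¹) else 0) - (√(1 + (n : ℝ)⁻¹) + (√n)⁻¹) / n

theorem inner_simplexVertex_none {n : ℕ} (x : EuclideanSpace ℝ (Fin n)) :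
    ⟪x, simplexVertex n none⟫ = (√n)⁻¹ * ∑ j, x j := by
  rw [EuclideanSpace.real_inner_eq_sum, Finset.mul_sum]
  exact Finset.sum_congr rfl fun j _ => mul_comm _ _

theorem inner_simplexVertex_some {n : ℕ} (x : EuclideanSpace ℝ (Fin n)) (i : Fin n) :
    ⟪x, simplexVertex n (some i)⟫ =
      √(1 + (n : ℝ)⁻¹) * x i - (√(1 + (n : ℝ)⁻¹) + (√n)⁻¹) / n * ∑ j, x j := by
  rw [EuclideanSpace.real_inner_eq_sum]
  simp only [simplexVertex, mul_sub, Finset.sum_sub_distrib, ← Finset.sum_mul, mul_ite, mul_zero,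
    Finset.sum_ite_eq', Finset.mem_univ, if_true]
  ring

theorem sum_simplexVertex {n : ℕ} (hn : 0 < n) : ∑ i, simplexVertex n i = 0 := by
  have hn' : (n : ℝ) ≠ 0 := by positivity
  refine ext_inner_left ℝ fun x => ?_
  rw [inner_sum, inner_zero_right, Fintype.sum_option, inner_simplexVertex_none]
  simp only [inner_simplexVertex_some, Finset.sum_sub_distrib, ← Finset.mul_sum,
    Finset.sum_const, Finset.card_univ, Fintype.card_fin, nsmul_eq_mul]
  field_simp
  ring

theorem sum_inner_simplexVertex_sq {n : ℕ} (hn : 0 < n) (x : EuclideanSpace ℝ (Fin n)) :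
    ∑ i, ⟪x, simplexVertex n i⟫ ^ 2 = (1 + (n : ℝ)⁻¹) * ‖x‖ ^ 2 := by
  have hn' : (n : ℝ) ≠ 0 := by positivity
  rw [Fintype.sum_option, inner_simplexVertex_none, EuclideanSpace.real_norm_sq_eq]
  simp only [inner_simplexVertex_some]
  set σ := ∑ j, x j with hσ
  set α := √(1 + (n : ℝ)⁻¹) with hα
  set r := (√(n : ℝ))⁻¹ with hr
  have hα2 : α ^ 2 = 1 + (n : ℝ)⁻¹ := Real.sq_sqrt (by positivity)
  have hr2 : r ^ 2 = (n : ℝ)⁻¹ := by rw [hr, inv_pow, Real.sq_sqrt (by positivity)]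
  have h1 : ∀ j, (α * x j - (α + r) / n * σ) ^ 2 =
      α ^ 2 * x j ^ 2 - 2 * α * ((α + r) / n) * σ * x j + ((α + r) / n * σ) ^ 2 := fun j => by ring
  simp only [h1, Finset.sum_add_distrib, Finset.sum_sub_distrib, ← Finset.mul_sum,
    Finset.sum_const, Finset.card_univ, Fintype.card_fin, nsmul_eq_mul, ← hσ]
  rw [hα2]
  have h2 : (n : ℝ) * ((α + r) / n * σ) ^ 2 = (α + r) ^ 2 / n * σ ^ 2 := by
    field_simp
  rw [h2]
  linear_combination (-σ ^ 2 / n) * hα2 + (σ ^ 2 + σ ^ 2 / n) * hr2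

theorem norm_simplexVertex {n : ℕ} (hn : 0 < n) (i : Option (Fin n)) :
    ‖simplexVertex n i‖ = 1 := by
  have hn' : (n : ℝ) ≠ 0 := by positivity
  rw [← sq_eq_sq₀ (norm_nonneg _) zero_le_one, one_pow, ← real_inner_self_eq_norm_sq]
  cases i with
  | none =>
    rw [inner_simplexVertex_none]
    simp only [simplexVertex, Finset.sum_const, Finset.card_univ, Fintype.card_fin, nsmul_eq_mul]
    have : √(n : ℝ) ^ 2 = n := Real.sq_sqrt (by positivity)
    field_simp
    linarith
  | some i =>
    rw [inner_simplexVertex_some]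
    simp only [simplexVertex, Finset.sum_sub_distrib, Finset.sum_ite_eq', Finset.mem_univ, if_true,
      Finset.sum_const, Finset.card_univ, Fintype.card_fin, nsmul_eq_mul]
    set α := √(1 + (n : ℝ)⁻¹) with hα
    set r := (√(n : ℝ))⁻¹ with hr
    have hα2 : α ^ 2 = 1 + (n : ℝ)⁻¹ := Real.sq_sqrt (by positivity)
    have hr2 : r ^ 2 = (n : ℝ)⁻¹ := by rw [hr, inv_pow, Real.sq_sqrt (by positivity)]
    have h1 : (n : ℝ) * ((α + r) / n) = α + r := by field_simp
    rw [h1]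
    linear_combination (1 - 1 / (n : ℝ)) * hα2 + 1 / (n : ℝ) * hr2

/-- The point with coordinates `a` on `A` and `b` off `A`. -/
noncomputable def twoValued {n : ℕ} (a b : ℝ) (A : Finset (Fin n)) : EuclideanSpace ℝ (Fin n) :=
  WithLp.toLp 2 fun j => if j ∈ A then a else b

theorem sum_twoValued {n : ℕ} (a b : ℝ) (A : Finset (Fin n)) :
    ∑ j, twoValued a b A j = a * A.card + b * (n - A.card) := by
  have h : ∀ j, twoValued a b A j = b + if j ∈ A then a - b else 0 := fun j => by
    simp only [twoValued]; split_ifs <;> ring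
  simp only [h, Finset.sum_add_distrib, Finset.sum_ite_mem, Finset.univ_inter, Finset.sum_const,
    Finset.card_univ, Fintype.card_fin, nsmul_eq_mul]
  ring

theorem inner_twoValued {n : ℕ} (p a b : ℝ) (A B : Finset (Fin n)) :
    ⟪twoValued p 0 A, twoValued a b B⟫ =
      p * (a * (A ∩ B).card + b * (A.card - (A ∩ B).card)) := by
  rw [EuclideanSpace.real_inner_eq_sum]
  have h : ∀ j, twoValued p 0 A j * twoValued a b B j =
      (if j ∈ A then p * b else 0) + if j ∈ A ∩ B then p * (a - b) else 0 := fun j => by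
    by_cases h1 : j ∈ A <;> by_cases h2 : j ∈ B <;> simp [twoValued, h1, h2]
    ring
  simp only [h, Finset.sum_add_distrib, Finset.sum_ite_mem, Finset.univ_inter, Finset.sum_const,
    nsmul_eq_mul]
  ring

theorem norm_twoValued_sq {n : ℕ} (a b : ℝ) (A : Finset (Fin n)) :
    ‖twoValued a b A‖ ^ 2 = a ^ 2 * A.card + b ^ 2 * (n - A.card) := by
  rw [EuclideanSpace.real_norm_sq_eq, ← sum_twoValued]
  refine Finset.sum_congr rfl fun j _ => ?_
  simp only [twoValued]
  split_ifs <;> rfl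

/-- A body in John's position whose polytopal approximations at scale `√n` need many facets. -/
theorem exists_body_facets_ge {n k : ℕ} (hn : 640 ≤ n) (hk : k * 64 ≤ n) (hk' : n < k * 64 + 64) :
    ∃ K : Set (EuclideanSpace ℝ (Fin n)), IsConvexBody K ∧ InJohnPosition K ∧
      ∀ (m : ℕ) (w : Fin m → EuclideanSpace ℝ (Fin n)),
        K ⊆ {x | ∀ l, ⟪x, w l⟫ ≤ 1} →
        {x : EuclideanSpace ℝ (Fin n) | ∀ l, ⟪x, w l⟫ ≤ 1} ⊆ √n • K →
          (128 / 71 : ℝ) ^ k ≤ m * (2 * n) := by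
  obtain ⟨C, hCk, hCinter, hCcard⟩ := exists_finset_family_small_inter hk
  have hn0 : 0 < n := by omega
  have hnR : (640 : ℝ) ≤ n := by exact_mod_cast hn
  have hkR : (k : ℝ) * 64 ≤ n := by exact_mod_cast hk
  have hkR' : (n : ℝ) < k * 64 + 64 := by exact_mod_cast hk'
  have hs : 1 ≤ √(n : ℝ) := Real.one_le_sqrt.2 (by linarith)
  have hs2 : √(n : ℝ) * √n = n := Real.mul_self_sqrt (by linarith)
  set s := √(n : ℝ) with hs_def
  have hcoef : (√(1 + (n : ℝ)⁻¹) + s⁻¹) ≤ 4 / 3 := by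
    have h1 : √(1 + (n : ℝ)⁻¹) ≤ 1 + 1 / 640 := by
      rw [Real.sqrt_le_left (by norm_num)]
      have : (n : ℝ)⁻¹ ≤ 640⁻¹ := inv_anti₀ (by norm_num) hnR
      norm_num at this ⊢
      linarith
    have h2 : s⁻¹ ≤ 25⁻¹ := inv_anti₀ (by norm_num) (Real.le_sqrt_of_sq_le (by linarith))
    norm_num at h1 h2 ⊢
    linarith
  have hself : ∀ A ∈ C, ⟪twoValued (-48) 0 A, twoValued (-(3 / 2) / s) (3 / 4 / s) A⟫
      = 72 * k / s := fun A hA => by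
    rw [inner_twoValued, Finset.inter_self, hCk A hA]; ring
  obtain ⟨K, hK, hJ, hm⟩ := exists_inJohnPosition_many_facets (simplexVertex n)
    (fun _ => (n : ℝ) / (n + 1)) (fun _ => by positivity) (norm_simplexVertex hn0)
    (fun x => by
      rw [← Finset.mul_sum, sum_inner_simplexVertex_sq hn0]
      field_simp)
    (by rw [← Finset.smul_sum, sum_simplexVertex hn0, smul_zero])
    (by
      simp only [Finset.sum_const, Finset.card_univ, Fintype.card_option, Fintype.card_fin,
        nsmul_eq_mul]
      push_cast
      field_simp
      exact le_rfl)
    (Finset.univ : Finset C) (fun A => twoValued (-(3 / 2) / s) (3 / 4 / s) A.1)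
    (fun A => twoValued (-48) 0 A.1) (2 * n) (by positivity)
    (fun A => by
      rw [← sq_le_one_iff₀ (norm_nonneg _), norm_twoValued_sq, hCk A.1 A.2, div_pow, div_pow, sq s,
        hs2]
      field_simp
      linarith)
    (fun A _ i => by
      have hsum : ∑ j, twoValued (-48) 0 A.1 j = -48 * k := by
        rw [sum_twoValued, hCk A.1 A.2]; ring
      cases i with
      | none =>
        rw [inner_simplexVertex_none, hsum]
        have : 0 ≤ s⁻¹ * (48 * k) := by positivity
        linarith
      | some i =>
        rw [inner_simplexVertex_some, hsum]
        have h1 : twoValued (-48) 0 A.1 i ≤ 0 := by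
          simp only [twoValued]; split_ifs <;> norm_num
        have h2 : √(1 + (n : ℝ)⁻¹) * twoValued (-48) 0 A.1 i ≤ 0 :=
          mul_nonpos_of_nonneg_of_nonpos (Real.sqrt_nonneg _) h1
        have h3 : (√(1 + (n : ℝ)⁻¹) + s⁻¹) / n * (48 * k) ≤ 1 := by
          rw [div_mul_eq_mul_div, div_le_one (by positivity)]
          have := mul_le_mul_of_nonneg_right hcoef (show (0 : ℝ) ≤ 48 * k by positivity)
          linarith
        linarith)
    (fun A _ B _ hAB => by
      have hint : (3 : ℝ) * (A.1 ∩ B.1).card ≤ k := by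
        exact_mod_cast hCinter A.1 A.2 B.1 B.2 fun h => hAB (Subtype.ext h)
      rw [inner_twoValued, hCk A.1 A.2]
      have h1 : -48 * (-(3 / 2) / s * ((A.1 ∩ B.1).card : ℝ) +
          3 / 4 / s * (k - (A.1 ∩ B.1).card)) =
          36 * (3 * (A.1 ∩ B.1).card - k) / s := by ring
      rw [h1]
      exact div_nonpos_of_nonpos_of_nonneg (by linarith) (by linarith))
    (fun A _ => by
      rw [hself A.1 A.2, lt_div_iff₀ (by positivity), hs2]
      linarith)
    (fun A _ => by
      rw [hself A.1 A.2, div_le_iff₀ (by positivity)]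
      nlinarith)
  refine ⟨K, hK, hJ, fun m w h1 h2 => hCcard.trans ?_⟩
  simpa using hm m w h1 h2

theorem exponential_lower_bound_at_sqrt_n_scale :
    ∃ c : ℝ, 0 < c ∧
      ∀ᶠ n : ℕ in Filter.atTop,
        ∃ K : Set (EuclideanSpace ℝ (Fin n)), IsConvexBody K ∧ InJohnPosition K ∧
          ∀ (m : ℕ) (w : Fin m → EuclideanSpace ℝ (Fin n)),
            K ⊆ {x | ∀ l, ⟪x, w l⟫ ≤ 1} →
            {x : EuclideanSpace ℝ (Fin n) | ∀ l, ⟪x, w l⟫ ≤ 1} ⊆ Real.sqrt n • K →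
            (m : ℝ) ≥ Real.exp (c * n) := by
  refine ⟨1 / 256, by norm_num, ?_⟩
  have hexp : ∀ᶠ n : ℕ in Filter.atTop, 2 * Real.exp (1 / 2) * n ≤ Real.exp (1 / 256 * n) := by
    have h1 := (isLittleO_pow_exp_pos_mul_atTop (b := 1 / 256) 1 (by norm_num)).comp_tendsto
      tendsto_natCast_atTop_atTop
    have h2 := h1.bound (c := (2 * Real.exp (1 / 2))⁻¹) (by positivity)
    filter_upwards [h2] with n hn
    simp only [Function.comp_apply, pow_one, Real.norm_eq_abs, Nat.abs_cast, Real.abs_exp] at hn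
    rwa [← le_inv_mul_iff₀ (by positivity)]
  filter_upwards [hexp, Filter.eventually_ge_atTop 640] with n hn hn640
  obtain ⟨K, hK, hJ, hm⟩ := exists_body_facets_ge (k := n / 64) hn640 (by omega) (by omega)
  refine ⟨K, hK, hJ, fun m w h1 h2 => ?_⟩
  have hmk := hm m w h1 h2
  have hnpos : (0 : ℝ) < n := by exact_mod_cast (show 0 < n by omega)
  have hk : (n : ℝ) ≤ 64 * (n / 64 : ℕ) + 64 := by
    exact_mod_cast (show n ≤ 64 * (n / 64) + 64 by omega)
  have hbase : Real.exp (1 / 2) ≤ 128 / 71 := by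
    have h3 : Real.exp (1 / 2) ^ 2 = Real.exp 1 := by rw [← Real.exp_nat_mul]; norm_num
    have := Real.exp_one_lt_d9
    refine le_of_sq_le_sq ?_ (by norm_num)
    rw [h3]; norm_num at this ⊢; linarith
  have hpow : Real.exp (1 / 128 * n - 1 / 2) ≤ (128 / 71 : ℝ) ^ (n / 64) := by
    refine le_trans ?_ (pow_le_pow_left₀ (Real.exp_pos _).le hbase _)
    rw [← Real.exp_nat_mul, Real.exp_le_exp]
    linarith
  have hsplit : Real.exp (1 / 128 * n - 1 / 2) * Real.exp (1 / 2) =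
      Real.exp (1 / 256 * n) * Real.exp (1 / 256 * n) := by
    rw [← Real.exp_add, ← Real.exp_add]; ring_nf
  have hE := Real.exp_pos (1 / 256 * (n : ℝ))
  have hfin : Real.exp (1 / 256 * n) * (2 * Real.exp (1 / 2) * n) ≤
      m * (2 * Real.exp (1 / 2) * n) := by
    calc _ ≤ Real.exp (1 / 256 * n) * Real.exp (1 / 256 * n) :=
          mul_le_mul_of_nonneg_left hn hE.le
      _ = Real.exp (1 / 128 * n - 1 / 2) * Real.exp (1 / 2) := hsplit.symm
      _ ≤ m * (2 * n) * Real.exp (1 / 2) :=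
          mul_le_mul_of_nonneg_right (hpow.trans hmk) (Real.exp_pos _).le
      _ = _ := by ring
  exact le_of_mul_le_mul_right hfin (by positivity)
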